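/- Let L ⊂ ℝ^n be a bimodular lattice of rank n and let ξ ∈ Char_+(L) (respectively ξ ∈ Char_−(L)). Then: (1) for every v ∈ L, ξ + 2v ∈ Char_+(L) (respectively Char_−(L)); and (2) for every w ∈ L' \ L, ξ + 2w ∈ Char_−(L) (respectively Char_+(L)). In particular Char_+(L) and Char_−(L) are each affine spaces over 2L, and translation by an element of 2L' \ 2L swaps them. -/

import Mathlib

open scoped RealInnerProductSpace

noncomputable section

/-- The dual of a subset of Euclidean space: vectors pairing integrally with everything. -/
def dualSet {n : ℕ} (Λ : Set (EuclideanSpace ℝ (Fin n))) : Set (EuclideanSpace ℝ (Fin n)) :=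
  {x | ∀ v ∈ Λ, ∃ k : ℤ, ⟪x, v⟫ = (k : ℝ)}

/-- A (positive definite integral) lattice of full rank `n` in `ℝ^n`: an additive subgroup,
free abelian of rank `n` (it has a `ℤ`-basis indexed by `Fin n`), spanning `ℝ^n` over `ℝ`,
with all pairwise inner products integral. -/
def IsLattice {n : ℕ} (Λ : Set (EuclideanSpace ℝ (Fin n))) : Prop :=
  (0 ∈ Λ ∧ (∀ x ∈ Λ, ∀ y ∈ Λ, x + y ∈ Λ) ∧ (∀ x ∈ Λ, -x ∈ Λ)) ∧
  (∃ b : Fin n → EuclideanSpace ℝ (Fin n),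
      (∀ i, b i ∈ Λ) ∧ LinearIndependent ℤ b ∧
      ∀ x ∈ Λ, ∃ c : Fin n → ℤ, x = ∑ i, (c i : ℝ) • b i) ∧
  Submodule.span ℝ Λ = ⊤ ∧
  ∀ v ∈ Λ, ∀ w ∈ Λ, ∃ k : ℤ, ⟪v, w⟫ = (k : ℝ)

/-- A unimodular lattice: a lattice equal to its own dual. -/
def IsUnimodular {n : ℕ} (Λ : Set (EuclideanSpace ℝ (Fin n))) : Prop :=
  IsLattice Λ ∧ dualSet Λ = Λ

/-- A bimodular lattice: a lattice of index 2 in its dual. -/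
def IsBimodular {n : ℕ} (Λ : Set (EuclideanSpace ℝ (Fin n))) : Prop :=
  IsLattice Λ ∧
  ∃ w ∈ dualSet Λ \ Λ, ∀ x ∈ dualSet Λ, x ∈ Λ ∨ x - w ∈ Λ

/-- Characteristic covectors: elements `ξ` of the dual with `ξ·v ≡ v·v (mod 2)` for all `v ∈ Λ`. -/
def CharSet {n : ℕ} (Λ : Set (EuclideanSpace ℝ (Fin n))) : Set (EuclideanSpace ℝ (Fin n)) :=
  {ξ | ξ ∈ dualSet Λ ∧ ∀ v ∈ Λ, ∃ k : ℤ, ⟪ξ, v⟫ - ⟪v, v⟫ = 2 * (k : ℝ)}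

/-- `CharSign Λ ε` (for `ε = ±1`): characteristic covectors with `ξ·ξ ≡ n + ε (mod 8)`. -/
def CharSign {n : ℕ} (Λ : Set (EuclideanSpace ℝ (Fin n))) (ε : ℤ) :
    Set (EuclideanSpace ℝ (Fin n)) :=
  {ξ | ξ ∈ CharSet Λ ∧ ∃ k : ℤ, ⟪ξ, ξ⟫ = (n : ℝ) + (ε : ℝ) + 8 * (k : ℝ)}

/-- The defect `d(Λ) = min_{ξ ∈ Char(Λ)} (ξ·ξ − n)/4` of a full-rank lattice in `ℝ^n`. -/
def defect {n : ℕ} (Λ : Set (EuclideanSpace ℝ (Fin n))) : ℝ :=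
  sInf ((fun ξ => (⟪ξ, ξ⟫ - (n : ℝ)) / 4) '' CharSet Λ)

/-- The two defects `d_±(L) = min_{ξ ∈ Char_±(L)} (ξ·ξ − n)/4` of a bimodular lattice. -/
def defectSign {n : ℕ} (Λ : Set (EuclideanSpace ℝ (Fin n))) (ε : ℤ) : ℝ :=
  sInf ((fun ξ => (⟪ξ, ξ⟫ - (n : ℝ)) / 4) '' CharSign Λ ε)

/-- The juxtaposition `(x, y) ∈ ℝ^n × ℝ^m = ℝ^{n+m}`. -/
def pairE {n m : ℕ} (x : EuclideanSpace ℝ (Fin n)) (y : EuclideanSpace ℝ (Fin m)) :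
    EuclideanSpace ℝ (Fin (n + m)) :=
  (EuclideanSpace.equiv (Fin (n + m)) ℝ).symm
    (Fin.append (EuclideanSpace.equiv (Fin n) ℝ x) (EuclideanSpace.equiv (Fin m) ℝ y))

/-- The first component `ℝ^{n+m} → ℝ^n` of a covector. -/
def restFst {n m : ℕ} (ξ : EuclideanSpace ℝ (Fin (n + m))) : EuclideanSpace ℝ (Fin n) :=
  (EuclideanSpace.equiv (Fin n) ℝ).symm
    (fun i => EuclideanSpace.equiv (Fin (n + m)) ℝ ξ (Fin.castAdd m i))

/-- The second component `ℝ^{n+m} → ℝ^m` of a covector. -/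
def restSnd {n m : ℕ} (ξ : EuclideanSpace ℝ (Fin (n + m))) : EuclideanSpace ℝ (Fin m) :=
  (EuclideanSpace.equiv (Fin m) ℝ).symm
    (fun i => EuclideanSpace.equiv (Fin (n + m)) ℝ ξ (Fin.natAdd n i))

/-- The orthogonal direct sum `L ⊕ A ⊂ ℝ^{n+m}`, i.e. the subgroup `L × A`. -/
def prodSet {n m : ℕ} (L : Set (EuclideanSpace ℝ (Fin n))) (A : Set (EuclideanSpace ℝ (Fin m))) :
    Set (EuclideanSpace ℝ (Fin (n + m))) :=
  {z | ∃ x ∈ L, ∃ y ∈ A, z = pairE x y}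

/-- The overlattice `U_A = (L × A) ∪ ((L' \ L) × (A' \ A)) ⊂ ℝ^{n+m}`. -/
def overLattice {n m : ℕ} (L : Set (EuclideanSpace ℝ (Fin n)))
    (A : Set (EuclideanSpace ℝ (Fin m))) : Set (EuclideanSpace ℝ (Fin (n + m))) :=
  prodSet L A ∪ prodSet (dualSet L \ L) (dualSet A \ A)

/-- The standard lattice `I^n = ℤ^n ⊂ ℝ^n`. -/
def stdLattice (n : ℕ) : Set (EuclideanSpace ℝ (Fin n)) :=
  {x | ∀ i : Fin n, ∃ k : ℤ, x i = (k : ℝ)}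

/-- A lattice is diagonal if it admits a `ℤ`-basis with Gram matrix `diag(1, …, 1, 2)`,
i.e. it is isomorphic to `Δ_n = I^{n-1} ⊕ A_1`. -/
def IsDiagonal {n : ℕ} (Λ : Set (EuclideanSpace ℝ (Fin n))) : Prop :=
  ∃ b : Fin n → EuclideanSpace ℝ (Fin n),
    (∀ i, b i ∈ Λ) ∧ LinearIndependent ℤ b ∧
    (∀ x ∈ Λ, ∃ c : Fin n → ℤ, x = ∑ i, (c i : ℝ) • b i) ∧
    (∀ i j : Fin n, ⟪b i, b j⟫ =
      if i = j then (if (i : ℕ) = n - 1 then 2 else 1) else 0)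

/-- A lattice has an orthonormal `ℤ`-basis iff it is isomorphic to the standard lattice `I^n`. -/
def HasOrthonormalZBasis {n : ℕ} (Λ : Set (EuclideanSpace ℝ (Fin n))) : Prop :=
  ∃ b : Fin n → EuclideanSpace ℝ (Fin n),
    (∀ i, b i ∈ Λ) ∧ LinearIndependent ℤ b ∧
    (∀ x ∈ Λ, ∃ c : Fin n → ℤ, x = ∑ i, (c i : ℝ) • b i) ∧
    (∀ i j : Fin n, ⟪b i, b j⟫ = if i = j then 1 else 0)

/-- Periodicity of the theta function under translation by even integers. -/
theorem jacobiTheta_add_two_mul (b : ℕ) (τ : ℂ) :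
    jacobiTheta (τ + 2 * b) = jacobiTheta τ := by
  induction b with
  | zero => simp
  | succ b ih =>
    rw [← ih, ← jacobiTheta_two_add (τ + 2 * b)]
    push_cast
    ring_nf

theorem jacobiTheta_functional_equation (τ : ℂ) :
    jacobiTheta τ = ((-Complex.I * τ) ^ (1 / 2 : ℂ))⁻¹ * jacobiTheta (-1 / τ) := by
  rw [jacobiTheta_eq_jacobiTheta₂, jacobiTheta_eq_jacobiTheta₂, jacobiTheta₂_functional_equation]
  simp

open Complex in
theorem jacobiTheta_inv_even_add (b : ℕ) (hb : 0 < b) (t : ℝ) (ht : 0 < t) :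
    jacobiTheta (1 / (2 * b) + t * I) =
      (Real.sqrt (2 * b * t))⁻¹ * cexp (Real.pi / 4 * I) *
        jacobiTheta (-1 / (2 * b) + (1 / ((2 * b) ^ 2 * t) : ℝ) * I) := by
  have hb' : (0 : ℝ) < b := by exact_mod_cast hb
  have hbc : (b : ℂ) ≠ 0 := by exact_mod_cast hb.ne'
  have htc : (t : ℂ) ≠ 0 := by exact_mod_cast ht.ne'
  set τ : ℂ := 1 / (2 * b) + t * I with hτ
  set σ : ℂ := 2 * b * t * I / τ with hσ
  have hτim : 0 < τ.im := by
    have : (1 / (2 * b) : ℂ) = ((1 / (2 * b) : ℝ) : ℂ) := by push_cast; rfl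
    rw [hτ, this]; simpa using ht
  have hτ0 : τ ≠ 0 := by rintro h; simp [h] at hτim
  have hσ0 : σ ≠ 0 := by simp [hσ, hτ0, hbc, htc]
  have h1 : -1 / τ + 2 * b = σ := by
    rw [hσ]; field_simp; rw [hτ]; field_simp; ring
  have h2 : -1 / σ = -1 / (2 * b) + (1 / ((2 * b) ^ 2 * t) : ℝ) * I := by
    rw [hσ, neg_div, one_div_div, hτ]; push_cast; field_simp
    linear_combination (-1 : ℂ) * I_sq
  have hx : 0 < (-I * τ).re := by simpa using hτim
  have hσim : 0 < σ.im := by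
    rw [← h1]
    have : (-1 / τ + 2 * b).im = (-1 / τ).im := by
      simp
    rw [this, neg_div, neg_im, one_div, inv_im, neg_div, neg_neg]
    exact div_pos hτim (normSq_pos.2 hτ0)
  have hy : 0 < (-I * σ).re := by simpa using hσim
  have hxy : (-I * τ) * (-I * σ) = (2 * b * t : ℝ) * -I := by
    have : τ * σ = 2 * b * t * I := by rw [hσ]; field_simp
    calc _ = I ^ 2 * (τ * σ) := by ring
      _ = _ := by rw [this, I_sq]; push_cast; ring
  have hlog : log (-I * τ) + log (-I * σ) = Real.log (2 * b * t) + -(Real.pi / 2) * I := by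
    rw [← log_mul (mul_ne_zero (by simp) hτ0) (mul_ne_zero (by simp) hσ0), hxy,
      log_ofReal_mul (by positivity) (by simp), log_neg_I]
    · have A := abs_lt.1 (abs_arg_lt_pi_div_two_iff.2 (Or.inl hx))
      have B := abs_lt.1 (abs_arg_lt_pi_div_two_iff.2 (Or.inl hy))
      constructor <;> linarith [A.1, A.2, B.1, B.2]
  rw [jacobiTheta_functional_equation τ, ← jacobiTheta_add_two_mul b (-1 / τ), h1,
    jacobiTheta_functional_equation σ, h2, ← mul_assoc]
  congr 1
  rw [cpow_def_of_ne_zero (mul_ne_zero (by simp) hτ0),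
    cpow_def_of_ne_zero (mul_ne_zero (by simp) hσ0), ← exp_neg, ← exp_neg, ← exp_add]
  have : (-(log (-I * τ) * (1 / 2)) + -(log (-I * σ) * (1 / 2)))
      = ((-(Real.log (2 * b * t) / 2) : ℝ) : ℂ) + Real.pi / 4 * I := by
    calc _ = -(1 / 2) * (log (-I * τ) + log (-I * σ)) := by ring
      _ = _ := by rw [hlog]; push_cast; ring
  rw [this, exp_add, ← ofReal_exp, Real.exp_neg, ← Real.log_sqrt (by positivity),
    Real.exp_log (by positivity)]

open Complex in
theorem jacobiTheta_inv_add_eq_sum (a : ℕ) [NeZero a] (ha : Even a) (t : ℝ) (ht : 0 < t) :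
    jacobiTheta (1 / a + t * I) = ∑ r : Fin a, cexp (Real.pi * I * (r : ℕ) ^ 2 / a) *
      (HurwitzZeta.evenKernel ((r : ℕ) / a : ℝ) (a ^ 2 * t) : ℝ) := by
  have ha0 : (a : ℂ) ≠ 0 := by exact_mod_cast NeZero.ne a
  have ha0' : (0 : ℝ) < a := by exact_mod_cast Nat.pos_of_ne_zero (NeZero.ne a)
  have him : 0 < ((1 / a : ℂ) + t * I).im := by
    have : (1 / a : ℂ) = ((1 / a : ℝ) : ℂ) := by push_cast; rfl
    rw [this]; simpa using ht
  have hs := hasSum_jacobiTheta₂_term 0 him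
  rw [← jacobiTheta_eq_jacobiTheta₂] at hs
  rw [← (Int.divModEquiv a).symm.hasSum_iff, ← (Equiv.prodComm _ _).hasSum_iff] at hs
  have hfib : ∀ r : Fin a, HasSum
      (fun m : ℤ => jacobiTheta₂_term (m * a + (r : ℕ)) 0 (1 / a + t * I))
      (cexp (Real.pi * I * (r : ℕ) ^ 2 / a) *
      (HurwitzZeta.evenKernel ((r : ℕ) / a : ℝ) (a ^ 2 * t) : ℝ)) := by
    intro r
    have h := (hasSum_ofReal.2 (HurwitzZeta.hasSum_int_evenKernel ((r : ℕ) / a : ℝ)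
      (t := a ^ 2 * t) (by positivity))).mul_left (cexp (Real.pi * I * (r : ℕ) ^ 2 / a))
    refine (congrArg (HasSum · _) (funext fun m => ?_)).mpr h
    obtain ⟨b, hb⟩ := ha
    have hab : (a : ℂ) = 2 * b := by rw [hb]; push_cast; ring
    rw [jacobiTheta₂_term, ofReal_exp, ← exp_add, exp_eq_exp_iff_exists_int]
    refine ⟨m ^ 2 * b + m * (r : ℕ), ?_⟩
    push_cast
    field_simp
    rw [hab]
    linear_combination (2 * b * t * (2 * b * m + r) ^ 2 : ℂ) * I_sq
  have := hs.prod_fiberwise (fun r => hfib r)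
  exact this.unique (hasSum_fintype _)

open Filter Topology in
theorem tendsto_sqrt_mul_evenKernel (x : UnitAddCircle) :
    Tendsto (fun s : ℝ => Real.sqrt s * HurwitzZeta.evenKernel x s) (𝓝[>] 0) (𝓝 1) := by
  obtain ⟨p, hp, hO⟩ := HurwitzZeta.isBigO_atTop_cosKernel_sub x
  have h0 : Tendsto (fun y : ℝ => Real.exp (-p * y)) atTop (𝓝 0) :=
    Real.tendsto_exp_atBot.comp (tendsto_id.const_mul_atTop_of_neg (by linarith))
  have h1 : Tendsto (fun y => HurwitzZeta.cosKernel x y) atTop (𝓝 1) := by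
    simpa using (hO.trans_tendsto h0).add_const 1
  have h2 := h1.comp tendsto_inv_nhdsGT_zero
  refine h2.congr' ?_
  filter_upwards [self_mem_nhdsWithin] with s hs
  have hs' : 0 < Real.sqrt s := Real.sqrt_pos.2 hs
  rw [HurwitzZeta.evenKernel_functional_equation, ← Real.sqrt_eq_rpow]
  simp only [Function.comp, one_div]
  field_simp

open Complex Filter Topology in
/-- The quadratic Gauss sum of even modulus with half-integral exponent. -/
theorem sum_exp_sq_div (b : ℕ) (hb : 0 < b) :
    ∑ r : Fin (2 * b), cexp (Real.pi * I * (r : ℕ) ^ 2 / (2 * b : ℕ)) =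
      Real.sqrt (2 * b) * cexp (Real.pi / 4 * I) := by
  have hb' : (0 : ℝ) < b := by exact_mod_cast hb
  have : NeZero (2 * b) := ⟨by omega⟩
  have hL : Tendsto (fun s : ℝ => ∑ r : Fin (2 * b),
      cexp (Real.pi * I * (r : ℕ) ^ 2 / (2 * b : ℕ)) *
        ((Real.sqrt s * HurwitzZeta.evenKernel ((r : ℕ) / (2 * b : ℕ) : ℝ) s : ℝ) : ℂ))
      (𝓝[>] 0) (𝓝 (∑ r : Fin (2 * b),
        cexp (Real.pi * I * (r : ℕ) ^ 2 / (2 * b : ℕ)) * ((1 : ℝ) : ℂ))) :=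
    tendsto_finsetSum _ fun r _ =>
      ((continuous_ofReal.tendsto 1).comp (tendsto_sqrt_mul_evenKernel _)).const_mul _
  have hJ : Tendsto (fun s : ℝ => jacobiTheta (-1 / (2 * b) + (1 / s : ℝ) * I))
      (𝓝[>] 0) (𝓝 1) := by
    have hc : Tendsto (fun s : ℝ => (-1 / (2 * b) + (1 / s : ℝ) * I : ℂ)) (𝓝[>] 0)
        (comap im atTop) := by
      rw [tendsto_comap_iff]
      refine tendsto_inv_nhdsGT_zero.congr fun s => ?_
      have : (-1 / (2 * b) : ℂ) = ((-1 / (2 * b) : ℝ) : ℂ) := by push_cast; rfl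
      rw [Function.comp, this]
      simp only [add_im, ofReal_im, mul_I_im, ofReal_re]
      simp
    have h0 : Tendsto (fun τ : ℂ => Real.exp (-Real.pi * τ.im)) (comap im atTop) (𝓝 0) :=
      Real.tendsto_exp_atBot.comp
        (tendsto_comap.const_mul_atTop_of_neg (by linarith [Real.pi_pos]))
    have h1 := isBigO_at_im_infty_jacobiTheta_sub_one.trans_tendsto h0
    simpa using (h1.comp hc).add_const 1
  have hR : Tendsto (fun s : ℝ => (Real.sqrt (2 * b) * cexp (Real.pi / 4 * I)) *
      jacobiTheta (-1 / (2 * b) + (1 / s : ℝ) * I)) (𝓝[>] 0)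
      (𝓝 (Real.sqrt (2 * b) * cexp (Real.pi / 4 * I) * 1)) := hJ.const_mul _
  simp only [ofReal_one, mul_one] at hL hR
  refine tendsto_nhds_unique_of_eventuallyEq hL hR ?_
  filter_upwards [self_mem_nhdsWithin] with s hs
  have hs : 0 < s := hs
  have ht : 0 < s / (2 * b) ^ 2 := by positivity
  have e1 := jacobiTheta_inv_add_eq_sum (2 * b) (even_two_mul b) _ ht
  have e2 := jacobiTheta_inv_even_add b hb _ ht
  have e3 : ((2 * b : ℕ) : ℝ) ^ 2 * (s / (2 * b) ^ 2) = s := by push_cast; field_simp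
  have e4 : (2 * b : ℝ) ^ 2 * (s / (2 * b) ^ 2) = s := by field_simp
  have e5 : Real.sqrt s = Real.sqrt (2 * b) * Real.sqrt (2 * b * (s / (2 * b) ^ 2)) := by
    rw [← Real.sqrt_mul (by positivity)]; congr 1; field_simp
  have e6 : (Real.sqrt (2 * b * (s / (2 * b) ^ 2)) : ℂ) ≠ 0 := by
    exact_mod_cast (Real.sqrt_pos.2 (by positivity)).ne'
  rw [e3] at e1
  rw [e4] at e2
  push_cast at e1 e2 ⊢
  rw [e2] at e1
  calc _ = (Real.sqrt s : ℂ) * ∑ r : Fin (2 * b),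
      cexp (Real.pi * I * (r : ℕ) ^ 2 / (2 * b)) *
        (HurwitzZeta.evenKernel ((r : ℕ) / (2 * b) : ℝ) s : ℂ) := by
        rw [Finset.mul_sum]; exact Finset.sum_congr rfl fun r _ => by ring
    _ = _ := by
        rw [← e1, e5]
        push_cast
        generalize (Real.sqrt (2 * b * (s / (2 * b) ^ 2)) : ℂ) = u at e6 ⊢
        generalize jacobiTheta _ = v
        field_simp

/-- The quadratic phase `exp (π i (k² + c k) / a)` on `ℤ / a`. -/
def quadPhase (a : ℕ) (c : ℤ) (k : ZMod a) : ℂ :=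
  Complex.exp (Real.pi * Complex.I * ((k.val : ℂ) ^ 2 + k.val * c) / a)

open Complex in
theorem quadPhase_intCast (b : ℕ) (hb : 0 < b) (d m : ℤ) :
    quadPhase (2 * b) (2 * d) (m : ZMod (2 * b)) =
      cexp (Real.pi * I * ((m : ℂ) ^ 2 + m * (2 * d)) / (2 * b)) := by
  have : NeZero (2 * b) := ⟨by omega⟩
  have hbc : (b : ℂ) ≠ 0 := by exact_mod_cast hb.ne'
  have hv : (((m : ZMod (2 * b)).val : ℤ)) = m - 2 * b * (m / (2 * b : ℕ)) := by
    rw [ZMod.val_intCast, Int.emod_def]; push_cast; ring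
  have hv' : (((m : ZMod (2 * b)).val : ℂ)) = m - 2 * b * ((m / (2 * b : ℕ) : ℤ) : ℂ) := by
    exact_mod_cast congrArg (Int.cast : ℤ → ℂ) hv
  rw [quadPhase, hv', exp_eq_exp_iff_exists_int]
  refine ⟨-(m * (m / (2 * b : ℕ))) + b * (m / (2 * b : ℕ)) ^ 2 - (m / (2 * b : ℕ)) * d, ?_⟩
  generalize (m / (2 * b : ℕ) : ℤ) = q
  push_cast
  field_simp
  ring

open Complex in
theorem stdAddChar_mul_intCast (b : ℕ) [NeZero (2 * b)] (m k : ℤ) :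
    ZMod.stdAddChar ((m : ZMod (2 * b)) * (k : ZMod (2 * b))) =
      cexp (2 * Real.pi * I * (m * k / (2 * b))) := by
  rw [← Int.cast_mul, ZMod.stdAddChar_coe]
  push_cast
  ring_nf

open Complex in
theorem quadPhase_add (b : ℕ) [NeZero (2 * b)] (d : ℤ) (g h : ZMod (2 * b)) :
    quadPhase (2 * b) (2 * d) (g + h) =
      quadPhase (2 * b) (2 * d) g * quadPhase (2 * b) (2 * d) h * ZMod.stdAddChar (g * h) := by
  have hb : 0 < b := by have := NeZero.ne (2 * b); omega
  have hbc : (b : ℂ) ≠ 0 := by exact_mod_cast hb.ne'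
  obtain ⟨m, rfl⟩ := ZMod.intCast_surjective g
  obtain ⟨k, rfl⟩ := ZMod.intCast_surjective h
  rw [← Int.cast_add, quadPhase_intCast b hb, quadPhase_intCast b hb, quadPhase_intCast b hb,
    stdAddChar_mul_intCast, ← exp_add, ← exp_add]
  congr 1
  push_cast
  field_simp
  ring

open Complex in
theorem sum_quadPhase (b : ℕ) [NeZero (2 * b)] (d : ℤ) :
    ∑ k, quadPhase (2 * b) (2 * d) k =
      Real.sqrt (2 * b) * cexp (Real.pi * I * (1 / 4 - d ^ 2 / (2 * b))) := by
  have hb : 0 < b := by have := NeZero.ne (2 * b); omega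
  have hbc : (b : ℂ) ≠ 0 := by exact_mod_cast hb.ne'
  have hshift : ∀ k : ZMod (2 * b), quadPhase (2 * b) (2 * d) k =
      quadPhase (2 * b) (2 * 0) (k + (d : ZMod (2 * b))) *
        cexp (-(Real.pi * I * (d ^ 2 / (2 * b)))) := by
    intro k
    obtain ⟨m, rfl⟩ := ZMod.intCast_surjective k
    rw [← Int.cast_add, quadPhase_intCast b hb, quadPhase_intCast b hb, ← exp_add]
    congr 1
    push_cast
    field_simp
    ring
  have hfin : ∑ k : ZMod (2 * b), quadPhase (2 * b) (2 * 0) k =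
      ∑ r : Fin (2 * b), cexp (Real.pi * I * (r : ℕ) ^ 2 / (2 * b : ℕ)) := by
    have hbij : Function.Bijective fun r : Fin (2 * b) => (((r : ℕ) : ℤ) : ZMod (2 * b)) := by
      rw [Fintype.bijective_iff_injective_and_card, ZMod.card, Fintype.card_fin]
      refine ⟨fun r s hrs => Fin.ext ?_, rfl⟩
      simpa [ZMod.natCast_eq_natCast_iff', Nat.mod_eq_of_lt] using hrs
    rw [← hbij.sum_comp]
    refine Finset.sum_congr rfl fun r _ => ?_
    rw [quadPhase_intCast b hb]
    simp
  have hsum : ∑ k : ZMod (2 * b), quadPhase (2 * b) (2 * 0) (k + (d : ZMod (2 * b))) =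
      ∑ k : ZMod (2 * b), quadPhase (2 * b) (2 * 0) k :=
    Equiv.sum_comp (Equiv.addRight (d : ZMod (2 * b))) _
  simp_rw [hshift]
  rw [← Finset.sum_mul, hsum, hfin, sum_exp_sq_div b hb, mul_assoc, ← exp_add]
  congr 2
  ring

/-- Summing a quadratic function over a finite group whose subgroup `H` is isotropic and has
orthogonal complement `H ∪ (w + H)`. -/
theorem sum_eq_card_mul_one_add {G : Type*} [AddCommGroup G] [Fintype G] (H : AddSubgroup G)
    [Fintype H] (F : G → ℂ) (β : G → AddChar G ℂ)
    (hadd : ∀ g h, F (g + h) = F g * F h * β g h) (hF : ∀ h ∈ H, F h = 1) (w : G) (hw : w ∉ H)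
    (hβ : ∀ g, (∀ h ∈ H, β g h = 1) ↔ g ∈ H ∨ g - w ∈ H) :
    ∑ g, F g = Fintype.card H * (1 + F w) := by
  classical
  have hcard : (Fintype.card H : ℂ) ≠ 0 := by exact_mod_cast Fintype.card_ne_zero
  have hchar : ∀ g, ∑ h : H, β g h = if g ∈ H ∨ g - w ∈ H then (Fintype.card H : ℂ) else 0 := by
    intro g
    have := AddChar.sum_eq_ite ((β g).compAddMonoidHom H.subtype)
    simp only [AddChar.compAddMonoidHom_apply, AddSubgroup.coe_subtype] at this
    rw [this]
    refine if_congr ?_ rfl rfl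
    rw [← hβ, AddChar.eq_zero_iff]
    simp
  have hdouble : (Fintype.card H : ℂ) * ∑ g, F g =
      Fintype.card H * ∑ g, if g ∈ H ∨ g - w ∈ H then F g else 0 := by
    calc (Fintype.card H : ℂ) * ∑ g, F g = ∑ h : H, ∑ g, F (g + h) := by
          have hshift : ∀ h : H, ∑ g, F (g + h) = ∑ g, F g := fun h =>
            Equiv.sum_comp (Equiv.addRight (h : G)) F
          simp [hshift]
      _ = ∑ g, F g * ∑ h : H, β g h := by
          rw [Finset.sum_comm]
          refine Finset.sum_congr rfl fun g _ => ?_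
          rw [Finset.mul_sum]
          refine Finset.sum_congr rfl fun h _ => ?_
          rw [hadd, hF h h.2, mul_one]
      _ = _ := by
          rw [Finset.mul_sum]
          refine Finset.sum_congr rfl fun g _ => ?_
          rw [hchar]
          split_ifs <;> ring
  rw [mul_right_inj' hcard] at hdouble
  have hsplit : ∀ g, (if g ∈ H ∨ g - w ∈ H then F g else 0) =
      (if g ∈ H then (1 : ℂ) else 0) + if g - w ∈ H then F w else 0 := by
    intro g
    by_cases h1 : g ∈ H
    · have h2 : g - w ∉ H := fun h2 => hw (by simpa using H.sub_mem h1 h2)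
      simp [h1, h2, hF g h1]
    · by_cases h2 : g - w ∈ H
      · have h3 := (hβ w).2 (Or.inr (by simp)) _ h2
        have h4 := hadd w (g - w)
        rw [h3, hF _ h2, add_sub_cancel] at h4
        simp [h1, h2, h4]
      · simp [h1, h2]
  have hcount : ∀ c : ℂ, ∑ g, (if g ∈ H then c else 0) = Fintype.card H * c := by
    intro c
    rw [← Finset.sum_filter, Finset.sum_const, nsmul_eq_mul, Fintype.card_subtype]
  have hshift : ∑ g, (if g - w ∈ H then F w else 0) = ∑ g, if g ∈ H then F w else 0 :=
    Equiv.sum_comp (Equiv.subRight w) fun g => if g ∈ H then F w else 0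
  rw [hdouble]
  simp_rw [hsplit]
  rw [Finset.sum_add_distrib, hcount, hshift, hcount]
  ring

/-- A full-rank integral lattice contains an orthogonal family of nonzero vectors of full size. -/
theorem exists_orthogonal_mem {n : ℕ} (Λ : AddSubgroup (EuclideanSpace ℝ (Fin n)))
    (b : Fin n → EuclideanSpace ℝ (Fin n)) (hb : ∀ i, b i ∈ Λ) (hli : LinearIndependent ℝ b)
    (hint : ∀ v ∈ Λ, ∀ w ∈ Λ, ∃ k : ℤ, ⟪v, w⟫ = (k : ℝ)) :
    ∃ v : Fin n → EuclideanSpace ℝ (Fin n), (∀ i, v i ∈ Λ) ∧ (∀ i, v i ≠ 0) ∧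
      ∀ i j, i ≠ j → ⟪v i, v j⟫ = 0 := by
  let S : AddSubgroup (EuclideanSpace ℝ (Fin n)) :=
    { carrier := {x | ∃ N : ℕ, 0 < N ∧ N • x ∈ Λ}
      zero_mem' := ⟨1, one_pos, by simp⟩
      add_mem' := by
        rintro x y ⟨N, hN, hx⟩ ⟨M, hM, hy⟩
        refine ⟨M * N, Nat.mul_pos hM hN, ?_⟩
        rw [smul_add, mul_smul, mul_comm M N, mul_smul]
        exact Λ.add_mem (Λ.nsmul_mem hx M) (Λ.nsmul_mem hy N)
      neg_mem' := by
        rintro x ⟨N, hN, hx⟩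
        exact ⟨N, hN, by simpa using Λ.neg_mem hx⟩ }
  have hS : ∀ i, InnerProductSpace.gramSchmidt ℝ b i ∈ S := by
    intro i
    induction i using WellFoundedLT.induction with
    | ind i ih =>
      rw [eq_sub_of_add_eq (InnerProductSpace.gramSchmidt_def'' ℝ b i).symm]
      refine S.sub_mem ⟨1, one_pos, by simpa using hb i⟩ (S.sum_mem fun j hj => ?_)
      obtain ⟨N, hN, hp⟩ := ih j (Finset.mem_Iio.1 hj)
      set g := InnerProductSpace.gramSchmidt ℝ b j with hg
      have hg0 : g ≠ 0 := InnerProductSpace.gramSchmidt_ne_zero j hli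
      obtain ⟨A, hA⟩ := hint _ hp _ hp
      obtain ⟨B, hB⟩ := hint _ hp _ (hb i)
      have hN' : (0 : ℝ) < N := by exact_mod_cast hN
      simp only [← Nat.cast_smul_eq_nsmul ℝ, real_inner_smul_left, real_inner_smul_right] at hA hB
      have hgg : 0 < ⟪g, g⟫ := real_inner_self_pos.2 hg0
      have hApos : (0 : ℝ) < A := by rw [← hA]; positivity
      have hApos' : 0 < A := by exact_mod_cast hApos
      lift A to ℕ using hApos'.le
      refine ⟨A, by exact_mod_cast hApos', ?_⟩
      have : A • ((⟪g, b i⟫ / ((‖g‖ : ℝ) : ℝ) ^ 2) • g) = B • (N • g) := by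
        rw [← Nat.cast_smul_eq_nsmul ℝ, ← Nat.cast_smul_eq_nsmul ℝ, ← Int.cast_smul_eq_zsmul ℝ,
          smul_smul, smul_smul, ← hB, ← real_inner_self_eq_norm_sq]
        push_cast at hA
        rw [← hA]
        congr 1
        field_simp
      simpa using this ▸ Λ.zsmul_mem hp B
  choose N hN hv using hS
  refine ⟨fun i => N i • InnerProductSpace.gramSchmidt ℝ b i, hv, fun i => ?_, fun i j hij => ?_⟩
  · dsimp only
    rw [← Nat.cast_smul_eq_nsmul ℝ]
    exact smul_ne_zero (Nat.cast_ne_zero.2 (hN i).ne') (InnerProductSpace.gramSchmidt_ne_zero i hli)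
  · simp [← Nat.cast_smul_eq_nsmul ℝ, real_inner_smul_left, real_inner_smul_right,
      InnerProductSpace.gramSchmidt_orthogonal ℝ b hij]

/-- Expansion of a scalar product along an orthogonal family of full size. -/
theorem inner_eq_sum_of_orthogonal {n : ℕ} (v : Fin n → EuclideanSpace ℝ (Fin n))
    (h0 : ∀ i, v i ≠ 0) (hv : ∀ i j, i ≠ j → ⟪v i, v j⟫ = 0) (x : EuclideanSpace ℝ (Fin n)) :
    x = ∑ i, (⟪x, v i⟫ / ⟪v i, v i⟫) • v i := by
  have hspan : Submodule.span ℝ (Set.range v) = ⊤ :=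
    (linearIndependent_of_ne_zero_of_inner_eq_zero h0 hv).span_eq_top_of_card_eq_finrank' (by simp)
  set z := x - ∑ i, (⟪x, v i⟫ / ⟪v i, v i⟫) • v i with hz
  have hzv : ∀ j, ⟪z, v j⟫ = 0 := by
    intro j
    have hj : ⟪v j, v j⟫ ≠ 0 := (real_inner_self_pos.2 (h0 j)).ne'
    rw [hz, inner_sub_left, sum_inner, Finset.sum_eq_single j]
    · rw [real_inner_smul_left, div_mul_cancel₀ _ hj, sub_self]
    · intro i _ hij
      rw [real_inner_smul_left, hv i j hij, mul_zero]
    · simp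
  have hzz : ∀ y ∈ Submodule.span ℝ (Set.range v), ⟪z, y⟫ = 0 := by
    intro y hy
    induction hy using Submodule.span_induction with
    | mem y hy => obtain ⟨j, rfl⟩ := hy; exact hzv j
    | zero => simp
    | add x y _ _ hx hy => rw [inner_add_right, hx, hy, add_zero]
    | smul c x _ hx => rw [real_inner_smul_right, hx, mul_zero]
  exact sub_eq_zero.1 (inner_self_eq_zero.1 (hzz z (by rw [hspan]; trivial)))

open Complex in
/-- The argument of the Gauss sum of the discriminant form of a bimodular lattice. -/
theorem one_add_exp_eq {n : ℕ} (Λ : AddSubgroup (EuclideanSpace ℝ (Fin n)))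
    (e : Fin n → EuclideanSpace ℝ (Fin n)) (he : ∀ i, e i ∈ Λ) (hli : LinearIndependent ℝ e)
    (hint : ∀ v ∈ Λ, ∀ w ∈ Λ, ∃ k : ℤ, ⟪v, w⟫ = (k : ℝ)) (ξ : EuclideanSpace ℝ (Fin n))
    (hξ : ξ ∈ CharSet (Λ : Set (EuclideanSpace ℝ (Fin n)))) (w : EuclideanSpace ℝ (Fin n))
    (hwd : w ∈ dualSet (Λ : Set (EuclideanSpace ℝ (Fin n)))) (hw : w ∉ Λ)
    (hdual : ∀ x ∈ dualSet (Λ : Set (EuclideanSpace ℝ (Fin n))), x ∈ Λ ∨ x - w ∈ Λ) :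
    ∃ r : ℝ, 0 < r ∧ 1 + cexp (Real.pi * I * (⟪w, w⟫ + ⟪w, ξ⟫ : ℝ)) =
      r * cexp (Real.pi * I * ((n - ⟪ξ, ξ⟫) / 4 : ℝ)) := by
  classical
  obtain ⟨v, hvΛ, hv0, hvo, b, hb, hvb, d, hd⟩ : ∃ v : Fin n → EuclideanSpace ℝ (Fin n),
      (∀ i, v i ∈ Λ) ∧ (∀ i, v i ≠ 0) ∧ (∀ i j, i ≠ j → ⟪v i, v j⟫ = 0) ∧
      ∃ b : Fin n → ℕ, (∀ i, 0 < b i) ∧ (∀ i, ⟪v i, v i⟫ = 2 * (b i : ℝ)) ∧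
      ∃ d : Fin n → ℤ, ∀ i, ⟪v i, ξ⟫ = 2 * (d i : ℝ) := by
    obtain ⟨u, huΛ, hu0, huo⟩ := exists_orthogonal_mem Λ e he hli hint
    choose A hA using fun i => hint _ (huΛ i) _ (huΛ i)
    choose d hd using fun i => hξ.1 _ (huΛ i)
    have hApos : ∀ i, 0 < A i := fun i => by
      have := real_inner_self_pos.2 (hu0 i)
      rw [hA] at this
      exact_mod_cast this
    lift A to Fin n → ℕ using fun i => (hApos i).le
    refine ⟨fun i => (2 : ℕ) • u i, fun i => Λ.nsmul_mem (huΛ i) 2,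
      fun i => ?_, fun i j hij => ?_, fun i => 2 * A i,
      fun i => ?_, fun i => ?_, d, fun i => ?_⟩
    · dsimp only
      rw [← Nat.cast_smul_eq_nsmul ℝ]
      exact smul_ne_zero (by norm_num) (hu0 i)
    · simp [← Nat.cast_smul_eq_nsmul ℝ, real_inner_smul_left, real_inner_smul_right, huo i j hij]
    · have := hApos i; simp at this ⊢; omega
    · simp only [← Nat.cast_smul_eq_nsmul ℝ, real_inner_smul_left, real_inner_smul_right, hA]
      push_cast; ring
    · simp only [← Nat.cast_smul_eq_nsmul ℝ, real_inner_smul_left]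
      rw [real_inner_comm, hd, Nat.cast_ofNat]
  have hne : ∀ i, NeZero (2 * b i) := fun i => ⟨by have := hb i; omega⟩
  have hbR : ∀ i, (b i : ℝ) ≠ 0 := fun i => by exact_mod_cast (hb i).ne'
  have hexp : ∀ x y : EuclideanSpace ℝ (Fin n),
      ⟪x, y⟫ = ∑ i, ⟪x, v i⟫ * ⟪y, v i⟫ / (2 * b i) := by
    intro x y
    conv_lhs => rw [inner_eq_sum_of_orthogonal v hv0 hvo x, sum_inner]
    refine Finset.sum_congr rfl fun i _ => ?_
    rw [real_inner_smul_left, hvb, real_inner_comm y (v i)]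
    ring
  let F : (∀ i, ZMod (2 * b i)) → ℂ := fun g => ∏ i, quadPhase (2 * b i) (2 * d i) (g i)
  let β : (∀ i, ZMod (2 * b i)) → AddChar (∀ i, ZMod (2 * b i)) ℂ := fun g =>
    { toFun := fun h => ∏ i, ZMod.stdAddChar (g i * h i)
      map_zero_eq_one' := by simp
      map_add_eq_mul' := fun h k => by
        simp [mul_add, AddChar.map_add_eq_mul, Finset.prod_mul_distrib] }
  have hFrep : ∀ (x : EuclideanSpace ℝ (Fin n)) (k : Fin n → ℤ), (∀ i, ⟪x, v i⟫ = (k i : ℝ)) →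
      F (fun i => (k i : ZMod (2 * b i))) = cexp (Real.pi * I * (⟪x, x⟫ + ⟪x, ξ⟫ : ℝ)) := by
    intro x k hk
    simp only [F]
    rw [hexp x x, hexp x ξ, ← Finset.sum_add_distrib, ofReal_sum, Finset.mul_sum, exp_sum]
    refine Finset.prod_congr rfl fun i _ => ?_
    rw [quadPhase_intCast _ (hb i), hk, real_inner_comm, hd]
    push_cast
    ring_nf
  have hβrep : ∀ (x y : EuclideanSpace ℝ (Fin n)) (k l : Fin n → ℤ),
      (∀ i, ⟪x, v i⟫ = (k i : ℝ)) → (∀ i, ⟪y, v i⟫ = (l i : ℝ)) →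
      β (fun i => (k i : ZMod (2 * b i))) (fun i => (l i : ZMod (2 * b i))) =
        cexp (2 * Real.pi * I * (⟪x, y⟫ : ℝ)) := by
    intro x y k l hk hl
    change ∏ i, ZMod.stdAddChar ((k i : ZMod (2 * b i)) * (l i : ZMod (2 * b i))) = _
    rw [hexp x y, ofReal_sum, Finset.mul_sum, exp_sum]
    refine Finset.prod_congr rfl fun i _ => ?_
    rw [stdAddChar_mul_intCast, hk, hl]
    push_cast
    rfl
  have hlift : ∀ g : ∀ i, ZMod (2 * b i), ∃ (x : EuclideanSpace ℝ (Fin n)) (k : Fin n → ℤ),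
      (∀ i, ⟪x, v i⟫ = (k i : ℝ)) ∧ g = fun i => (k i : ZMod (2 * b i)) := by
    intro g
    choose k hk using fun i => ZMod.intCast_surjective (g i)
    refine ⟨∑ i, ((k i : ℝ) / (2 * b i)) • v i, k, fun j => ?_, funext fun i => (hk i).symm⟩
    rw [sum_inner, Finset.sum_eq_single j]
    · rw [real_inner_smul_left, hvb]
      have := hbR j
      field_simp
    · intro i _ hij
      rw [real_inner_smul_left, hvo i j hij, mul_zero]
    · simp
  have hcong : ∀ (x y : EuclideanSpace ℝ (Fin n)) (k l : Fin n → ℤ),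
      (∀ i, ⟪x, v i⟫ = (k i : ℝ)) → (∀ i, ⟪y, v i⟫ = (l i : ℝ)) →
      (fun i => (k i : ZMod (2 * b i))) = (fun i => (l i : ZMod (2 * b i))) → y ∈ Λ → x ∈ Λ := by
    intro x y k l hk hl hkl hy
    have hdvd : ∀ i, ∃ m : ℤ, k i - l i = (2 * b i : ℕ) * m := fun i => by
      have := (ZMod.intCast_eq_intCast_iff_dvd_sub _ _ _).1 (congrFun hkl i).symm
      exact this
    choose m hm using hdvd
    have hxy : x - y = ∑ i, m i • v i := by
      rw [inner_eq_sum_of_orthogonal v hv0 hvo (x - y)]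
      refine Finset.sum_congr rfl fun i _ => ?_
      rw [inner_sub_left, hk, hl, hvb, ← Int.cast_sub, hm, ← Int.cast_smul_eq_zsmul ℝ]
      congr 1
      have := hbR i
      push_cast
      field_simp
    have := Λ.add_mem (hxy ▸ Λ.sum_mem fun i _ => Λ.zsmul_mem (hvΛ i) (m i) : x - y ∈ Λ) hy
    simpa using this
  let H : AddSubgroup (∀ i, ZMod (2 * b i)) :=
    { carrier := {g | ∃ x ∈ Λ, ∃ k : Fin n → ℤ, (∀ i, ⟪x, v i⟫ = (k i : ℝ)) ∧
        g = fun i => (k i : ZMod (2 * b i))}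
      zero_mem' := ⟨0, Λ.zero_mem, 0, by simp, by ext; simp⟩
      add_mem' := by
        rintro _ _ ⟨x, hx, k, hk, rfl⟩ ⟨y, hy, l, hl, rfl⟩
        exact ⟨x + y, Λ.add_mem hx hy, k + l, by simp [inner_add_left, hk, hl], by ext; simp⟩
      neg_mem' := by
        rintro _ ⟨x, hx, k, hk, rfl⟩
        exact ⟨-x, Λ.neg_mem hx, -k, by simp [hk], by ext; simp⟩ }
  have hHrep : ∀ (x : EuclideanSpace ℝ (Fin n)) (k : Fin n → ℤ), (∀ i, ⟪x, v i⟫ = (k i : ℝ)) →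
      ((fun i => (k i : ZMod (2 * b i))) ∈ H ↔ x ∈ Λ) := by
    intro x k hk
    constructor
    · rintro ⟨y, hy, l, hl, hkl⟩
      exact hcong x y k l hk hl hkl hy
    · exact fun hx => ⟨x, hx, k, hk, rfl⟩
  choose kw hkw using fun i => hwd _ (hvΛ i)
  have hFH : ∀ h ∈ H, F h = 1 := by
    rintro _ ⟨x, hx, k, hk, rfl⟩
    obtain ⟨m, hm⟩ := hξ.2 x hx
    obtain ⟨p, hp⟩ := hint x hx x hx
    rw [hFrep x k hk, exp_eq_one_iff]
    refine ⟨p + m, ?_⟩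
    have : ⟪x, x⟫ + ⟪x, ξ⟫ = 2 * ((p + m : ℤ) : ℝ) := by
      rw [real_inner_comm x ξ] at hm
      push_cast
      linarith
    rw [this]
    push_cast
    ring
  have hβH : ∀ g, (∀ h ∈ H, β g h = 1) ↔
      g ∈ H ∨ g - (fun i => (kw i : ZMod (2 * b i))) ∈ H := by
    intro g
    obtain ⟨x, k, hk, rfl⟩ := hlift g
    have hsub : ((fun i => (k i : ZMod (2 * b i))) - fun i => (kw i : ZMod (2 * b i))) =
        fun i => ((k i - kw i : ℤ) : ZMod (2 * b i)) := by ext; simp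
    rw [hsub, hHrep x k hk,
      hHrep (x - w) (fun i => k i - kw i) (fun i => by simp [inner_sub_left, hk, hkw])]
    have hxd : (∀ h ∈ H, β (fun i => (k i : ZMod (2 * b i))) h = 1) ↔
        x ∈ dualSet (Λ : Set (EuclideanSpace ℝ (Fin n))) := by
      constructor
      · intro hx y hy
        choose l hl using fun i => hint y hy _ (hvΛ i)
        have h1 := hx _ ⟨y, hy, l, hl, rfl⟩
        rw [hβrep x y k l hk hl, exp_eq_one_iff] at h1
        obtain ⟨m, hm⟩ := h1
        refine ⟨m, ?_⟩
        have h2 : (2 * Real.pi * I : ℂ) ≠ 0 := two_pi_I_ne_zero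
        have h3 : ((⟪x, y⟫ : ℝ) : ℂ) = ((m : ℝ) : ℂ) := by
          apply mul_left_cancel₀ h2
          rw [hm]
          push_cast
          ring
        exact_mod_cast h3
      · rintro hx _ ⟨y, hy, l, hl, rfl⟩
        obtain ⟨m, hm⟩ := hx y hy
        rw [hβrep x y k l hk hl, exp_eq_one_iff, hm]
        exact ⟨m, by push_cast; ring⟩
    rw [hxd]
    refine ⟨hdual x, ?_⟩
    rintro (hx | hx)
    · exact fun y hy => hint x hx y hy
    · intro y hy
      obtain ⟨p, hp⟩ := hint _ hx y hy
      obtain ⟨q, hq⟩ := hwd y hy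
      refine ⟨p + q, ?_⟩
      rw [inner_sub_left, hq] at hp
      push_cast
      linarith
  have hsum := sum_eq_card_mul_one_add H F β
    (fun g h => by
      change ∏ i, quadPhase (2 * b i) (2 * d i) ((g + h) i) =
        (∏ i, quadPhase (2 * b i) (2 * d i) (g i)) * (∏ i, quadPhase (2 * b i) (2 * d i) (h i)) *
          ∏ i, ZMod.stdAddChar (g i * h i)
      simp only [← Finset.prod_mul_distrib, Pi.add_apply, quadPhase_add])
    hFH _ ((hHrep w kw hkw).not.2 hw) hβH
  rw [hFrep w kw hkw] at hsum
  have hgauss : ∑ g, F g = ((∏ i, Real.sqrt (2 * b i) : ℝ) : ℂ) *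
      cexp (Real.pi * I * ((n - ⟪ξ, ξ⟫) / 4 : ℝ)) := by
    simp only [F]
    rw [← Fintype.prod_sum]
    simp_rw [sum_quadPhase]
    rw [Finset.prod_mul_distrib, ← exp_sum, ofReal_prod, ← Finset.mul_sum]
    congr 4
    rw [hexp ξ ξ]
    simp_rw [real_inner_comm _ ξ, hd]
    push_cast
    rw [Finset.sum_sub_distrib, sub_div, Finset.sum_div]
    congr 1
    · simp; ring
    · refine Finset.sum_congr rfl fun i _ => ?_
      ring
  have hcard : (0 : ℝ) < Fintype.card H := by exact_mod_cast Fintype.card_pos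
  have hcard' : (Fintype.card H : ℂ) ≠ 0 := by exact_mod_cast hcard.ne'
  refine ⟨(∏ i, Real.sqrt (2 * b i)) / Fintype.card H, div_pos (Finset.prod_pos fun i _ =>
    Real.sqrt_pos.2 (by have := hb i; positivity)) hcard, ?_⟩
  apply mul_left_cancel₀ hcard'
  rw [← hsum, hgauss]
  generalize cexp _ = z
  push_cast
  field_simp

theorem exists_eq_of_one_add_exp_eq (θ : ℝ) (ε : ℤ) (hε : ε = 1 ∨ ε = -1) (k : ℤ) (r : ℝ)
    (hr : 0 < r) (h : 1 + Complex.exp (Real.pi * Complex.I * (θ : ℝ)) =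
      r * Complex.exp (Real.pi * Complex.I * ((-ε - 8 * k) / 4 : ℝ))) :
    ∃ m : ℤ, θ = -ε / 2 + 2 * m := by
  have hper : Complex.exp (Real.pi * Complex.I * ((-ε - 8 * k) / 4 : ℝ)) =
      Complex.exp (((-(ε * (Real.pi / 4)) : ℝ) : ℂ) * Complex.I) := by
    rw [Complex.exp_eq_exp_iff_exists_int]
    exact ⟨-k, by push_cast; ring⟩
  have hθ : (Real.pi * Complex.I * (θ : ℝ) : ℂ) = ((Real.pi * θ : ℝ) : ℂ) * Complex.I := by
    push_cast; ring
  rw [hper, hθ] at h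
  have hre := congrArg Complex.re h
  have him := congrArg Complex.im h
  simp only [Complex.add_re, Complex.add_im, Complex.one_re, Complex.one_im,
    Complex.re_ofReal_mul, Complex.im_ofReal_mul, Complex.exp_ofReal_mul_I_re,
    Complex.exp_ofReal_mul_I_im, Real.cos_neg, Real.sin_neg, zero_add] at hre him
  have hcs := Real.sin_sq_add_cos_sq (Real.pi * θ)
  have h2 : Real.sqrt 2 ^ 2 = 2 := Real.sq_sqrt (by norm_num)
  have hs2 : 0 < Real.sqrt 2 := by positivity
  have hs1 : ∀ s : ℝ, 0 < s → s ^ 2 + (s - 1) ^ 2 = 1 → s = 1 := fun s hs h => by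
    have : s * (s - 1) = 0 := by linarith
    rcases mul_eq_zero.1 this with h | h <;> linarith
  have hsin : Real.sin (Real.pi * θ) = -ε := by
    have hs : 0 < r * (Real.sqrt 2 / 2) := by positivity
    have key : r * (Real.sqrt 2 / 2) = 1 := by
      apply hs1 _ hs
      rcases hε with rfl | rfl
      · simp only [Int.cast_one, one_mul, Real.cos_pi_div_four, Real.sin_pi_div_four] at hre him
        rw [him, eq_sub_of_add_eq' hre] at hcs
        linarith
      · simp only [Int.reduceNeg, Int.cast_neg, Int.cast_one, neg_mul, one_mul, Real.cos_neg,
          Real.sin_neg, neg_neg, Real.cos_pi_div_four, Real.sin_pi_div_four] at hre him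
        rw [him, eq_sub_of_add_eq' hre] at hcs
        linarith
    rcases hε with rfl | rfl
    · simp only [Int.cast_one, one_mul, Real.sin_pi_div_four] at him
      rw [him, mul_neg, key, Int.cast_one]
    · simp only [Int.reduceNeg, Int.cast_neg, Int.cast_one, neg_mul, one_mul,
          Real.sin_neg, neg_neg, Real.sin_pi_div_four] at him
      rw [him, key]; simp
  have hpi := Real.pi_pos
  have hone : Real.cos (Real.pi * θ + ε * (Real.pi / 2)) = 1 := by
    rcases hε with rfl | rfl
    · simp [Real.cos_add_pi_div_two, hsin]
    · simp [← sub_eq_add_neg, Real.cos_sub_pi_div_two, hsin]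
  obtain ⟨m, hm⟩ := (Real.cos_eq_one_iff _).1 hone
  refine ⟨m, mul_left_cancel₀ hpi.ne' ?_⟩
  linarith

theorem linearIndependent_of_span_eq_top {n : ℕ} {L : Set (EuclideanSpace ℝ (Fin n))}
    (hL : Submodule.span ℝ L = ⊤) (b : Fin n → EuclideanSpace ℝ (Fin n))
    (hb : ∀ x ∈ L, ∃ c : Fin n → ℤ, x = ∑ i, (c i : ℝ) • b i) : LinearIndependent ℝ b := by
  refine linearIndependent_of_top_le_span_of_card_eq_finrank ?_ (by simp)
  rw [← hL, Submodule.span_le]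
  intro x hx
  obtain ⟨c, rfl⟩ := hb x hx
  exact Submodule.sum_mem _ fun i _ => Submodule.smul_mem _ _ (Submodule.subset_span ⟨i, rfl⟩)

theorem add_two_smul_mem_charSet {n : ℕ} {L : Set (EuclideanSpace ℝ (Fin n))}
    {ξ w : EuclideanSpace ℝ (Fin n)} (hξ : ξ ∈ CharSet L) (hw : w ∈ dualSet L) :
    ξ + (2 : ℝ) • w ∈ CharSet L := by
  refine ⟨fun v hv => ?_, fun v hv => ?_⟩
  · obtain ⟨k, hk⟩ := hξ.1 v hv
    obtain ⟨l, hl⟩ := hw v hv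
    exact ⟨k + 2 * l, by rw [inner_add_left, real_inner_smul_left, hk, hl]; push_cast; ring⟩
  · obtain ⟨k, hk⟩ := hξ.2 v hv
    obtain ⟨l, hl⟩ := hw v hv
    exact ⟨k + l, by
      rw [inner_add_left, real_inner_smul_left, hl]
      push_cast
      linarith⟩

theorem inner_add_two_smul_self {n : ℕ} (ξ w : EuclideanSpace ℝ (Fin n)) :
    ⟪ξ + (2 : ℝ) • w, ξ + (2 : ℝ) • w⟫ = ⟪ξ, ξ⟫ + 4 * (⟪w, w⟫ + ⟪w, ξ⟫) := by
  simp only [inner_add_left, inner_add_right, real_inner_smul_left, real_inner_smul_right,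
    real_inner_comm w ξ]
  ring

theorem exists_inner_self_add_inner_eq {n : ℕ} {L : Set (EuclideanSpace ℝ (Fin n))}
    (hL : IsBimodular L) {ε : ℤ} (hε : ε = 1 ∨ ε = -1) {ξ : EuclideanSpace ℝ (Fin n)}
    (hξ : ξ ∈ CharSign L ε) {w : EuclideanSpace ℝ (Fin n)} (hw : w ∈ dualSet L \ L) :
    ∃ m : ℤ, ⟪w, w⟫ + ⟪w, ξ⟫ = -ε / 2 + 2 * (m : ℝ) := by
  obtain ⟨⟨⟨h0, hadd, hneg⟩, ⟨b, hbL, -, hspan⟩, htop, hint⟩, w₀, -, hw₀⟩ := hL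
  obtain ⟨hξc, k, hk⟩ := hξ
  let Λ : AddSubgroup (EuclideanSpace ℝ (Fin n)) :=
    { carrier := L
      zero_mem' := h0
      add_mem' := fun {x y} hx hy => hadd x hx y hy
      neg_mem' := fun {x} hx => hneg x hx }
  have hdual : ∀ x ∈ dualSet L, x ∈ Λ ∨ x - w ∈ Λ := fun x hx => by
    have hww : w - w₀ ∈ Λ := (hw₀ w hw.1).resolve_left hw.2
    refine (hw₀ x hx).imp id fun hx' => ?_
    have : x - w₀ - (w - w₀) ∈ Λ := Λ.sub_mem hx' hww
    rwa [sub_sub_sub_cancel_right] at this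
  obtain ⟨r, hr, h⟩ := one_add_exp_eq Λ b hbL (linearIndependent_of_span_eq_top htop b hspan)
    hint ξ hξc w hw.1 hw.2 hdual
  refine exists_eq_of_one_add_exp_eq _ ε hε k r hr ?_
  rw [h, hk]
  congr 4
  ring

/-- for a bimodular lattice `L` and `ξ ∈ Char_ε(L)` (`ε = ±1`), translation by
`2v` with `v ∈ L` preserves `Char_ε(L)`, while translation by `2w` with `w ∈ L' \ L`
sends it into `Char_{−ε}(L)`. -/
theorem stmt3 {n : ℕ} (L : Set (EuclideanSpace ℝ (Fin n))) (hL : IsBimodular L)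
    (ε : ℤ) (hε : ε = 1 ∨ ε = -1) (ξ : EuclideanSpace ℝ (Fin n)) (hξ : ξ ∈ CharSign L ε) :
    (∀ v ∈ L, ξ + (2 : ℝ) • v ∈ CharSign L ε) ∧
    (∀ w ∈ dualSet L \ L, ξ + (2 : ℝ) • w ∈ CharSign L (-ε)) := by
  obtain ⟨k, hk⟩ := hξ.2
  refine ⟨fun v hv => ⟨add_two_smul_mem_charSet hξ.1 (hL.1.2.2.2 v hv), ?_⟩,
    fun w hw => ⟨add_two_smul_mem_charSet hξ.1 hw.1, ?_⟩⟩
  · obtain ⟨p, hp⟩ := hL.1.2.2.2 v hv v hv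
    obtain ⟨q, hq⟩ := hξ.1.2 v hv
    rw [real_inner_comm] at hq
    refine ⟨k + p + q, ?_⟩
    rw [inner_add_two_smul_self, hk]
    push_cast
    linarith
  · obtain ⟨m, hm⟩ := exists_inner_self_add_inner_eq hL hε hξ hw
    refine ⟨k + m, ?_⟩
    rw [inner_add_two_smul_self, hk, hm]
    push_cast
    ring

end
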